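/- (Proposition on general parametric families, part (iii): consistency of the parametric-bootstrap test against fixed alternatives.) Under the same assumptions (a) and (b) as in part (i) — M = {P_θ : θ ∈ Θ} ⊆ measures on ℝ^d with finite p-th moment, θ ↦ P_θ one-to-one and W_p-continuous on (Θ, ρ), estimator θ̂_n weakly consistent locally uniformly in θ — let T_{M,n} = W_p^p(P̂_n, P_{θ̂_n}) and c_M(α, n, θ) = inf{t ≥ 0 : P_θⁿ[T_{M,n} ≤ t] ≥ 1−α}. Let P be a Borel probability measure on ℝ^d with P ∉ M (P need not have finite p-th moment), and suppose there exists a compact K ⊆ Θ such that Pⁿ[θ̂_n ∈ K] → 1 as n → ∞. Then for every α ∈ (0,1), lim_{n→∞} Pⁿ[ T_{M,n} ≥ c_M(α, n, θ̂_n) ] = 1. -/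

import Mathlib

open MeasureTheory ENNReal Filter Topology

noncomputable section

/-- `ℝ^d` as Euclidean space. -/
abbrev Euc (d : ℕ) : Type := EuclideanSpace ℝ (Fin d)

/-- The set of couplings of two Borel probability measures: probability measures on the
product space whose first marginal is `P` and second marginal is `Q`. -/
def couplings {E : Type*} [MeasurableSpace E] (P Q : Measure E) : Set (Measure (E × E)) :=
  {γ | IsProbabilityMeasure γ ∧ γ.map Prod.fst = P ∧ γ.map Prod.snd = Q}

/-- `W_p^p(P,Q)`: the `p`-th power of the `p`-Wasserstein distance,
`inf_{γ ∈ Γ(P,Q)} ∫ ‖x - y‖^p dγ(x,y)`, as an extended nonnegative real. -/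
def WpPow {E : Type*} [MeasurableSpace E] [NormedAddCommGroup E] (p : ℝ) (P Q : Measure E) :
    ℝ≥0∞ :=
  ⨅ γ ∈ couplings P Q, ∫⁻ z, ENNReal.ofReal (‖z.1 - z.2‖ ^ p) ∂γ

/-- The `p`-Wasserstein distance `W_p(P,Q)`. -/
def Wp {E : Type*} [MeasurableSpace E] [NormedAddCommGroup E] (p : ℝ) (P Q : Measure E) :
    ℝ≥0∞ :=
  WpPow p P Q ^ (1 / p)

/-- Empirical distribution `n⁻¹ ∑ᵢ δ_{x i}` of `n` points. -/
def empDist {E : Type*} [MeasurableSpace E] {n : ℕ} (x : Fin n → E) : Measure E :=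
  (n : ℝ≥0∞)⁻¹ • ∑ i, Measure.dirac (x i)

/-- The `n`-fold product measure `P^n` on `(ℝ^d)^n`. -/
def prodn {E : Type*} [MeasurableSpace E] (P : Measure E) (n : ℕ) : Measure (Fin n → E) :=
  Measure.pi fun _ => P

/-- `P` has a finite moment of order `p`. -/
def HasFinMom {E : Type*} [MeasurableSpace E] [NormedAddCommGroup E] (p : ℝ) (P : Measure E) :
    Prop :=
  ∫⁻ x, ENNReal.ofReal (‖x‖ ^ p) ∂P ≠ ∞


lemma aux_cost {d : ℕ} {p : ℝ} (hp : 1 ≤ p) (a b : Euc d) :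
    ENNReal.ofReal (‖a - b‖ ^ p) = edist a b ^ p := by
  rw [edist_dist, dist_eq_norm, ENNReal.ofReal_rpow_of_nonneg (norm_nonneg _) (by linarith)]

lemma aux_WpPow_le {d : ℕ} {p : ℝ} (hp : 1 ≤ p) {P Q : Measure (Euc d)}
    (γ : Measure (Euc d × Euc d)) (h : γ ∈ couplings P Q) :
    WpPow p P Q ≤ ∫⁻ z, edist z.1 z.2 ^ p ∂γ := by
  unfold WpPow
  refine (iInf₂_le γ h).trans (le_of_eq ?_)
  simp only [aux_cost hp]

lemma aux_WpPow_lt {d : ℕ} {p : ℝ} (hp : 1 ≤ p) {P Q : Measure (Euc d)} {c : ℝ≥0∞}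
    (h : WpPow p P Q < c) :
    ∃ γ ∈ couplings P Q, ∫⁻ z, edist z.1 z.2 ^ p ∂γ < c := by
  unfold WpPow at h
  simp only [iInf_lt_iff, aux_cost hp] at h
  obtain ⟨γ, hγ, h⟩ := h
  exact ⟨γ, hγ, h⟩

lemma aux_WpPow_comm_le {d : ℕ} {p : ℝ} (hp : 1 ≤ p) (P Q : Measure (Euc d)) :
    WpPow p P Q ≤ WpPow p Q P := by
  refine le_of_forall_gt fun c hc => ?_
  obtain ⟨γ, ⟨h1, h2, h3⟩, h⟩ := aux_WpPow_lt hp hc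
  refine (aux_WpPow_le hp (γ.map Prod.swap) ⟨?_, ?_, ?_⟩).trans_lt ?_
  · exact Measure.isProbabilityMeasure_map measurable_swap.aemeasurable
  · rw [Measure.map_map measurable_fst measurable_swap]; exact h3
  · rw [Measure.map_map measurable_snd measurable_swap]; exact h2
  · rw [lintegral_map (by fun_prop) measurable_swap]
    simpa [edist_comm] using h

lemma aux_WpPow_comm {d : ℕ} {p : ℝ} (hp : 1 ≤ p) (P Q : Measure (Euc d)) :
    WpPow p P Q = WpPow p Q P :=
  le_antisymm (aux_WpPow_comm_le hp P Q) (aux_WpPow_comm_le hp Q P)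

lemma aux_glue {E : Type*} [MeasurableSpace E] [StandardBorelSpace E] [Nonempty E]
    {P Q R : Measure E} {γ₁ γ₂ : Measure (E × E)}
    (h1 : γ₁ ∈ couplings P Q) (h2 : γ₂ ∈ couplings Q R) :
    ∃ ξ : Measure ((E × E) × E), IsProbabilityMeasure ξ ∧ ξ.map Prod.fst = γ₁ ∧
      ξ.map (fun z => (z.1.2, z.2)) = γ₂ := by
  obtain ⟨hp1, h1a, h1b⟩ := h1
  obtain ⟨hp2, h2a, h2b⟩ := h2
  refine ⟨Measure.compProd γ₁ (γ₂.condKernel.comap Prod.snd measurable_snd), inferInstance, ?_, ?_⟩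
  · exact Measure.fst_compProd _ _
  · conv_rhs => rw [← γ₂.disintegrate γ₂.condKernel]
    have hf : γ₂.fst = γ₁.map Prod.snd := by rw [h1b]; exact h2a
    rw [hf]
    have : IsProbabilityMeasure (γ₁.map Prod.snd) :=
      Measure.isProbabilityMeasure_map measurable_snd.aemeasurable
    ext s hs
    rw [Measure.map_apply (by fun_prop) hs, Measure.compProd_apply (hs.preimage (by fun_prop)),
      Measure.compProd_apply hs, lintegral_map (ProbabilityTheory.Kernel.measurable_kernel_prodMk_left hs)
        measurable_snd]
    rfl

lemma aux_tri {d : ℕ} {p : ℝ} (hp : 1 ≤ p) (P Q R : Measure (Euc d)) :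
    WpPow p P R ≤ 2 ^ (p - 1) * (WpPow p P Q + WpPow p Q R) := by
  have hc0 : (2 : ℝ≥0∞) ^ (p - 1) ≠ 0 := by simp
  have hct : (2 : ℝ≥0∞) ^ (p - 1) ≠ ∞ := by simp
  by_cases hA : WpPow p P Q = ∞
  · simp [hA, ENNReal.mul_top hc0]
  by_cases hB : WpPow p Q R = ∞
  · simp [hB, ENNReal.mul_top hc0]
  have key : ∀ a b : ℝ≥0∞, WpPow p P Q < a → WpPow p Q R < b →
      WpPow p P R ≤ 2 ^ (p - 1) * (a + b) := by
    intro a b ha hb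
    obtain ⟨γ₁, hγ₁, h1⟩ := aux_WpPow_lt hp ha
    obtain ⟨γ₂, hγ₂, h2⟩ := aux_WpPow_lt hp hb
    obtain ⟨ξ, hξ, e1, e2⟩ := aux_glue hγ₁ hγ₂
    have m2 : Measurable (fun z : (Euc d × Euc d) × Euc d => (z.1.2, z.2)) := by fun_prop
    have m3 : Measurable (fun z : (Euc d × Euc d) × Euc d => (z.1.1, z.2)) := by fun_prop
    refine (aux_WpPow_le hp (ξ.map (fun z => (z.1.1, z.2))) ⟨?_, ?_, ?_⟩).trans ?_
    · exact Measure.isProbabilityMeasure_map m3.aemeasurable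
    · rw [Measure.map_map measurable_fst m3, ← hγ₁.2.1, ← e1,
        Measure.map_map measurable_fst measurable_fst]
      rfl
    · rw [Measure.map_map measurable_snd m3, ← hγ₂.2.2, ← e2,
        Measure.map_map measurable_snd m2]
      rfl
    · rw [lintegral_map (by fun_prop) m3]
      rw [← e1, lintegral_map (by fun_prop) measurable_fst] at h1
      rw [← e2, lintegral_map (by fun_prop) m2] at h2
      calc ∫⁻ z, edist z.1.1 z.2 ^ p ∂ξ
          ≤ ∫⁻ z, 2 ^ (p - 1) * (edist z.1.1 z.1.2 ^ p + edist z.1.2 z.2 ^ p) ∂ξ := by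
            refine lintegral_mono fun z => ?_
            refine (ENNReal.rpow_le_rpow (edist_triangle z.1.1 z.1.2 z.2) (by linarith)).trans ?_
            exact ENNReal.rpow_add_le_mul_rpow_add_rpow _ _ hp
        _ = 2 ^ (p - 1) * (∫⁻ z, edist z.1.1 z.1.2 ^ p ∂ξ + ∫⁻ z, edist z.1.2 z.2 ^ p ∂ξ) := by
            rw [lintegral_const_mul _ (by fun_prop), lintegral_add_left (by fun_prop)]
        _ ≤ _ := by gcongr
  refine ENNReal.le_of_forall_pos_le_add fun ε hε _ => ?_
  have hδ : (0 : ℝ≥0∞) < ε / 2 ^ (p - 1) / 2 := by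
    simp [ENNReal.div_pos_iff, hε.ne', hct]
  refine (key _ _ (ENNReal.lt_add_right hA hδ.ne') (ENNReal.lt_add_right hB hδ.ne')).trans ?_
  rw [add_add_add_comm, ENNReal.add_halves, mul_add, ENNReal.mul_div_cancel hc0 hct]

lemma aux_map {d : ℕ} {p : ℝ} (hp : 1 ≤ p) (P : Measure (Euc d)) [IsProbabilityMeasure P]
    (T : Euc d → Euc d) (hT : Measurable T) :
    WpPow p P (P.map T) ≤ ∫⁻ x, edist x (T x) ^ p ∂P := by
  have m : Measurable (fun x => (x, T x)) := by fun_prop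
  refine (aux_WpPow_le hp (P.map (fun x => (x, T x))) ⟨?_, ?_, ?_⟩).trans ?_
  · exact Measure.isProbabilityMeasure_map m.aemeasurable
  · rw [Measure.map_map measurable_fst m]; exact Measure.map_id
  · rw [Measure.map_map measurable_snd m]; rfl
  · rw [lintegral_map (by fun_prop) m]

lemma aux_disc {d : ℕ} {p : ℝ} (hp : 1 ≤ p) (N : ℕ) (e : ℕ → Euc d) (a b : ℕ → ℝ≥0∞)
    (ha : ∑ j ∈ Finset.range N, a j = 1) (hb : ∑ j ∈ Finset.range N, b j = 1)
    (D : ℝ≥0∞) (hD : ∀ i ∈ Finset.range N, ∀ j ∈ Finset.range N, edist (e i) (e j) ^ p ≤ D) :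
    WpPow p (∑ j ∈ Finset.range N, a j • Measure.dirac (e j))
      (∑ j ∈ Finset.range N, b j • Measure.dirac (e j)) ≤
      D * ∑ j ∈ Finset.range N, (a j - b j) := by
  have hp0 : 0 < p := by linarith
  set F := Finset.range N with hF
  set r := ∑ j ∈ F, (a j - b j) with hr
  set r' := ∑ j ∈ F, (b j - a j) with hr'
  have sa : ∑ j ∈ F, min (a j) (b j) + r = 1 := by
    rw [hr, ← Finset.sum_add_distrib, ← ha]
    refine Finset.sum_congr rfl fun j _ => ?_
    rcases le_total (a j) (b j) with h | h
    · simp [h, tsub_eq_zero_of_le h]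
    · simp [h, add_tsub_cancel_of_le h]
  have sb : ∑ j ∈ F, min (a j) (b j) + r' = 1 := by
    rw [hr', ← Finset.sum_add_distrib, ← hb]
    refine Finset.sum_congr rfl fun j _ => ?_
    rcases le_total (a j) (b j) with h | h
    · simp [h, add_tsub_cancel_of_le h]
    · simp [h, tsub_eq_zero_of_le h]
  have hmt : ∑ j ∈ F, min (a j) (b j) ≠ ∞ := by
    intro h; rw [h] at sa; simp at sa
  have hrt : r ≠ ∞ := by
    intro h; rw [h] at sa; simp at sa
  have hrr : r' = r := by
    have := sb.trans sa.symm
    exact (ENNReal.add_right_inj hmt).1 this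
  have hc1 : ∀ i ∈ F, ∑ j ∈ F, r⁻¹ * ((a i - b i) * (b j - a j)) = a i - b i := by
    intro i hi
    rw [← Finset.mul_sum, ← Finset.mul_sum, ← hr', hrr]
    by_cases h0 : r = 0
    · have : a i - b i = 0 := by
        rw [hr] at h0; exact (Finset.sum_eq_zero_iff.1 h0) i hi
      simp [this]
    · rw [mul_comm, mul_assoc, ENNReal.mul_inv_cancel h0 hrt, mul_one]
  have hc2 : ∀ j ∈ F, ∑ i ∈ F, r⁻¹ * ((a i - b i) * (b j - a j)) = b j - a j := by
    intro j hj
    rw [← Finset.mul_sum, ← Finset.sum_mul, ← hr]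
    by_cases h0 : r = 0
    · have : b j - a j = 0 := by
        rw [← hrr, hr'] at h0; exact (Finset.sum_eq_zero_iff.1 h0) j hj
      simp [this]
    · rw [← mul_assoc, ENNReal.inv_mul_cancel h0 hrt, one_mul]
  set γ : Measure (Euc d × Euc d) := ∑ j ∈ F, (min (a j) (b j)) • Measure.dirac (e j, e j) +
    ∑ i ∈ F, ∑ j ∈ F, (r⁻¹ * ((a i - b i) * (b j - a j))) • Measure.dirac (e i, e j) with hγ
  have hfst : γ.map Prod.fst = ∑ j ∈ F, a j • Measure.dirac (e j) := by
    ext s hs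
    rw [Measure.map_apply measurable_fst hs]
    simp only [hγ, Measure.add_apply, Measure.finsetSum_apply, Measure.smul_apply, smul_eq_mul,
      Measure.dirac_apply' _ (measurable_fst hs), Measure.dirac_apply' _ hs]
    rw [← Finset.sum_add_distrib]
    refine Finset.sum_congr rfl fun i hi => ?_
    have : ∀ j, (Prod.fst ⁻¹' s).indicator (1 : Euc d × Euc d → ℝ≥0∞) (e i, e j)
        = s.indicator 1 (e i) := fun j => rfl
    simp only [this]
    rw [← Finset.sum_mul, hc1 i hi, ← add_mul]
    congr 1
    rcases le_total (a i) (b i) with h | h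
    · simp [h, tsub_eq_zero_of_le h]
    · simp [h, add_tsub_cancel_of_le h]
  have hsnd : γ.map Prod.snd = ∑ j ∈ F, b j • Measure.dirac (e j) := by
    ext s hs
    rw [Measure.map_apply measurable_snd hs]
    simp only [hγ, Measure.add_apply, Measure.finsetSum_apply, Measure.smul_apply, smul_eq_mul,
      Measure.dirac_apply' _ (measurable_snd hs), Measure.dirac_apply' _ hs]
    rw [Finset.sum_comm, ← Finset.sum_add_distrib]
    refine Finset.sum_congr rfl fun i hi => ?_
    have : ∀ j, (Prod.snd ⁻¹' s).indicator (1 : Euc d × Euc d → ℝ≥0∞) (e j, e i)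
        = s.indicator 1 (e i) := fun j => rfl
    simp only [this]
    rw [← Finset.sum_mul, hc2 i hi, ← add_mul]
    congr 1
    rcases le_total (a i) (b i) with h | h
    · simp [h, add_tsub_cancel_of_le h]
    · simp [h, tsub_eq_zero_of_le h]
  refine (aux_WpPow_le hp γ ⟨⟨?_⟩, hfst, hsnd⟩).trans ?_
  · have : γ Set.univ = γ.map Prod.fst Set.univ := by
      rw [Measure.map_apply measurable_fst MeasurableSet.univ]; rfl
    rw [this, hfst]
    simp [Measure.finsetSum_apply, ha]
  · simp only [hγ, lintegral_add_measure, lintegral_finsetSum_measure, lintegral_smul_measure,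
      lintegral_dirac, edist_self, ENNReal.zero_rpow_of_pos hp0, smul_eq_mul, mul_zero,
      Finset.sum_const_zero, zero_add]
    calc ∑ i ∈ F, ∑ j ∈ F, r⁻¹ * ((a i - b i) * (b j - a j)) * edist (e i) (e j) ^ p
        ≤ ∑ i ∈ F, ∑ j ∈ F, r⁻¹ * ((a i - b i) * (b j - a j)) * D := by
          refine Finset.sum_le_sum fun i hi => Finset.sum_le_sum fun j hj => ?_
          gcongr
          exact hD i hi j hj
      _ = ∑ i ∈ F, (a i - b i) * D := by
          refine Finset.sum_congr rfl fun i hi => ?_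
          rw [← Finset.sum_mul, hc1 i hi]
      _ = D * r := by rw [← Finset.sum_mul, mul_comm]
      _ ≤ _ := le_rfl

lemma aux_mapT {d : ℕ} (μ : Measure (Euc d)) (N : ℕ) (e : ℕ → Euc d) (ind : Euc d → ℕ)
    (hm : Measurable ind) (hle : ∀ x, ind x ∈ Finset.range N) :
    μ.map (fun x => e (ind x)) =
      ∑ j ∈ Finset.range N, μ (ind ⁻¹' {j}) • Measure.dirac (e j) := by
  have he : Measurable e := measurable_from_top
  ext s hs
  rw [Measure.map_apply (show Measurable fun x => e (ind x) from he.comp hm) hs]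
  simp only [Measure.finsetSum_apply, Measure.smul_apply, smul_eq_mul, Measure.dirac_apply' _ hs]
  have : (fun x => e (ind x)) ⁻¹' s = ⋃ j ∈ Finset.range N, (ind ⁻¹' {j} ∩ {x | e j ∈ s}) := by
    ext x
    simp only [Set.mem_preimage, Set.mem_iUnion, Set.mem_inter_iff, Set.mem_singleton_iff,
      Set.mem_ofPred_eq]
    constructor
    · intro h; exact ⟨ind x, hle x, rfl, h⟩
    · rintro ⟨j, _, rfl, h⟩; exact h
  rw [this, measure_biUnion_finset]
  · refine Finset.sum_congr rfl fun j _ => ?_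
    by_cases h : e j ∈ s <;> simp [h]
  · intro i _ j _ hij
    refine Set.disjoint_left.2 fun x hx hy => hij ?_
    exact hx.1.symm.trans hy.1
  · intro j _
    exact (hm (measurableSet_singleton j)).inter (MeasurableSet.const _)

lemma aux_small (K ε : ℝ≥0∞) (hK : K ≠ ∞) (hε : ε ≠ 0) : ∃ s : ℝ≥0∞, s ≠ 0 ∧ s ≠ ∞ ∧ s * K ≤ ε := by
  refine ⟨min 1 (ε / K), ?_, ?_, ?_⟩
  · have : 0 < min 1 (ε / K) := lt_min one_pos (ENNReal.div_pos hε hK)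
    exact this.ne'
  · exact ((min_le_left _ _).trans_lt ENNReal.one_lt_top).ne
  · exact (mul_le_mul_left (min_le_right _ _) K).trans (by rw [mul_comm]; exact ENNReal.mul_div_le)

lemma aux_emp_prob {d n : ℕ} (hn : n ≠ 0) (x : Fin n → Euc d) :
    IsProbabilityMeasure (empDist x) := by
  constructor
  simp [empDist, Measure.finsetSum_apply]
  rw [ENNReal.inv_mul_cancel] <;> simp [hn]

lemma aux_emp_lint {d n : ℕ} (x : Fin n → Euc d) (f : Euc d → ℝ≥0∞) :
    ∫⁻ y, f y ∂(empDist x) = (n : ℝ≥0∞)⁻¹ * ∑ i, f (x i) := by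
  simp [empDist, lintegral_finsetSum_measure, lintegral_smul_measure]

lemma aux_emp_int {d n : ℕ} (x : Fin n → Euc d) (f : Euc d → ℝ) :
    ∫ y, f y ∂(empDist x) = (n : ℝ)⁻¹ * ∑ i, f (x i) := by
  rw [empDist, integral_smul_measure, integral_finsetSum_measure]
  · simp
  · intro i _
    exact integrable_dirac (by simp)

lemma aux_markov {d n : ℕ} (hn : n ≠ 0) (μ : Measure (Euc d)) [IsProbabilityMeasure μ]
    (g : Euc d → ℝ≥0∞) (hg : Measurable g) (s : ℝ≥0∞) (hs : s ≠ 0) (hst : s ≠ ∞) :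
    prodn μ n {x | s ≤ ∫⁻ y, g y ∂(empDist x)} ≤ (∫⁻ y, g y ∂μ) / s := by
  have hm : Measurable fun x : Fin n → Euc d => ∑ i, g (x i) := by
    fun_prop
  simp only [aux_emp_lint]
  refine (meas_ge_le_lintegral_div (hm.const_mul _).aemeasurable hs hst).trans ?_
  gcongr
  rw [lintegral_const_mul _ hm, lintegral_finsetSum _ (fun i _ => by fun_prop)]
  have : ∀ i : Fin n, ∫⁻ x, g (x i) ∂(prodn μ n) = ∫⁻ y, g y ∂μ := by
    intro i
    exact (measurePreserving_eval (fun _ : Fin n => μ) i).lintegral_comp hg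
  simp only [this, Finset.sum_const, Finset.card_univ, Fintype.card_fin, nsmul_eq_mul]
  rw [← mul_assoc, ENNReal.inv_mul_cancel (by simp [hn]) (by simp), one_mul]

lemma aux_cheb {d n : ℕ} (hn : n ≠ 0) (μ : Measure (Euc d)) [IsProbabilityMeasure μ]
    (f : Euc d → ℝ) (hf : Measurable f) (hb : ∀ x, |f x| ≤ 1) (η : ℝ) (hη : 0 < η) :
    prodn μ n {x | η ≤ |∫ y, f y ∂(empDist x) - ∫ y, f y ∂μ|} ≤
      ENNReal.ofReal (1 / (n * η ^ 2)) := by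
  have hn' : (0 : ℝ) < n := by positivity
  have hL : MemLp f 2 μ := MemLp.of_bound hf.aestronglyMeasurable 1 (ae_of_all _ hb)
  have hI : Integrable f μ := hL.integrable (by norm_num)
  have hmp := fun i : Fin n => measurePreserving_eval (fun _ : Fin n => μ) i
  set X : (Fin n → Euc d) → ℝ := ∑ i : Fin n, fun x => f (x i) with hX
  have hprob : IsProbabilityMeasure (prodn μ n) := by unfold prodn; infer_instance
  have hXL : MemLp X 2 (prodn μ n) := by
    refine memLp_finsetSum' _ fun i _ => ?_
    exact hL.comp_measurePreserving (hmp i)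
  have hint : ∫ x, X x ∂(prodn μ n) = n * ∫ y, f y ∂μ := by
    simp only [hX, Finset.sum_apply]
    rw [integral_finsetSum]
    · have : ∀ i : Fin n, ∫ x, f (x i) ∂(prodn μ n) = ∫ y, f y ∂μ := by
        intro i
        conv_rhs => rw [← (hmp i).map_eq, integral_map (measurable_pi_apply i).aemeasurable
          hf.aestronglyMeasurable]
        rfl
      simp [this]
    · intro i _
      exact (hL.comp_measurePreserving (hmp i)).integrable (by norm_num)
  have hvar : ProbabilityTheory.variance X (prodn μ n) ≤ n := by
    have h1 : ProbabilityTheory.variance X (prodn μ n) =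
      ∑ i : Fin n, ProbabilityTheory.variance f μ :=
      ProbabilityTheory.variance_sum_pi (fun _ => hL)
    have h2 : ProbabilityTheory.variance f μ ≤ ((1 - (-1)) / 2) ^ 2 :=
      ProbabilityTheory.variance_le_sq_of_bounded
        (ae_of_all _ fun x => abs_le.1 (hb x)) hf.aemeasurable
    rw [h1]
    simp only [Finset.sum_const, Finset.card_univ, Fintype.card_fin, nsmul_eq_mul]
    nlinarith
  have hc : 0 < n * η := by positivity
  have := ProbabilityTheory.meas_ge_le_variance_div_sq hXL hc
  refine (measure_mono ?_).trans (this.trans (ENNReal.ofReal_le_ofReal ?_))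
  · intro x hx
    simp only [Set.mem_ofPred_eq, aux_emp_int] at hx ⊢
    rw [hint]
    have e : X x - n * ∫ y, f y ∂μ = n * ((n : ℝ)⁻¹ * ∑ i, f (x i) - ∫ y, f y ∂μ) := by
      simp only [hX, Finset.sum_apply]
      field_simp
    rw [e, abs_mul, abs_of_pos hn']
    gcongr
  · calc _ ≤ (n : ℝ) / (n * η) ^ 2 := by gcongr
      _ = _ := by field_simp

lemma aux_kant {d : ℕ} {p : ℝ} (hp : 1 ≤ p) (μ ν : Measure (Euc d)) [IsProbabilityMeasure μ]
    [IsProbabilityMeasure ν] (f : Euc d → ℝ) (L : NNReal) (hf : LipschitzWith L f)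
    (hb : ∀ x, |f x| ≤ 1) (η : ℝ) (hη : 0 < η) (h : WpPow p μ ν < ENNReal.ofReal (η ^ p)) :
    |∫ y, f y ∂μ - ∫ y, f y ∂ν| ≤ 2 * L * η := by
  obtain ⟨γ, ⟨h1, h2, h3⟩, hγ⟩ := aux_WpPow_lt hp h
  have hfm : Measurable f := hf.continuous.measurable
  have e1 : ∫ y, f y ∂μ = ∫ z, f z.1 ∂γ := by
    rw [← h2, integral_map measurable_fst.aemeasurable hfm.aestronglyMeasurable]
  have e2 : ∫ y, f y ∂ν = ∫ z, f z.2 ∂γ := by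
    rw [← h3, integral_map measurable_snd.aemeasurable hfm.aestronglyMeasurable]
  have i1 : Integrable (fun z : Euc d × Euc d => f z.1) γ :=
    Integrable.of_bound (hfm.comp measurable_fst).aestronglyMeasurable 1 (ae_of_all _ fun z => hb _)
  have i2 : Integrable (fun z : Euc d × Euc d => f z.2) γ :=
    Integrable.of_bound (hfm.comp measurable_snd).aestronglyMeasurable 1 (ae_of_all _ fun z => hb _)
  rw [e1, e2, ← integral_sub i1 i2]
  have key : ∀ t : ℝ, 0 ≤ t → t ≤ η + η ^ (1 - p) * t ^ p := by
    intro t ht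
    rcases le_total t η with h | h
    · have : 0 ≤ η ^ (1 - p) * t ^ p := by positivity
      linarith
    · have ht' : 0 < t := by linarith
      have : t = t ^ (1 - p) * t ^ p := by
        rw [← Real.rpow_add ht']; simp
      have h2 : t ^ (1 - p) ≤ η ^ (1 - p) :=
        Real.rpow_le_rpow_of_nonpos hη h (by linarith)
      calc t = t ^ (1 - p) * t ^ p := this
        _ ≤ η ^ (1 - p) * t ^ p := by gcongr
        _ ≤ _ := by linarith
  have hlin : ∫⁻ z, edist z.1 z.2 ∂γ ≤ ENNReal.ofReal (2 * η) := by
    calc ∫⁻ z, edist z.1 z.2 ∂γ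
        ≤ ∫⁻ z, (ENNReal.ofReal η + ENNReal.ofReal (η ^ (1 - p)) * edist z.1 z.2 ^ p) ∂γ := by
          refine lintegral_mono fun z => ?_
          rw [edist_dist, ENNReal.ofReal_rpow_of_nonneg dist_nonneg (by linarith),
            ← ENNReal.ofReal_mul (by positivity), ← ENNReal.ofReal_add hη.le (by positivity)]
          exact ENNReal.ofReal_le_ofReal (key _ dist_nonneg)
      _ = ENNReal.ofReal η + ENNReal.ofReal (η ^ (1 - p)) * ∫⁻ z, edist z.1 z.2 ^ p ∂γ := by
          rw [lintegral_add_left (by fun_prop), lintegral_const_mul _ (by fun_prop)]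
          simp
      _ ≤ ENNReal.ofReal η + ENNReal.ofReal (η ^ (1 - p)) * ENNReal.ofReal (η ^ p) := by
          gcongr
      _ = ENNReal.ofReal (2 * η) := by
          rw [← ENNReal.ofReal_mul (by positivity), ← ENNReal.ofReal_add hη.le (by positivity),
            ← Real.rpow_add hη]
          congr 1
          simp; ring
  have hfin : ‖∫ z, (f z.1 - f z.2) ∂γ‖ₑ ≤ ENNReal.ofReal (2 * L * η) := by
    refine (enorm_integral_le_lintegral_enorm _).trans ?_
    calc ∫⁻ z, ‖f z.1 - f z.2‖ₑ ∂γ ≤ ∫⁻ z, L * edist z.1 z.2 ∂γ := by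
          refine lintegral_mono fun z => ?_
          rw [← edist_eq_enorm_sub]
          exact hf z.1 z.2
      _ = L * ∫⁻ z, edist z.1 z.2 ∂γ := lintegral_const_mul _ (by fun_prop)
      _ ≤ L * ENNReal.ofReal (2 * η) := by gcongr
      _ = _ := by
          rw [← ENNReal.ofReal_coe_nnreal, ← ENNReal.ofReal_mul (by positivity)]
          congr 1; ring
  rw [← ofReal_norm, ENNReal.ofReal_le_ofReal_iff (by positivity)] at hfin
  exact hfin

lemma aux_quant {d : ℕ} {p : ℝ} (hp : 1 ≤ p) (Q : Measure (Euc d)) (hQ : HasFinMom p Q)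
    (η : ℝ≥0∞) (hη : η ≠ 0) :
    ∃ (e : ℕ → Euc d) (N : ℕ) (ind : Euc d → ℕ), Measurable ind ∧
      (∀ x, ind x ∈ Finset.range (N + 1)) ∧
      (∀ x y, edist x (e (ind x)) ≤ edist x y + edist y (e (ind y))) ∧
      ∫⁻ x, edist x (e (ind x)) ^ p ∂Q < η := by
  have hp0 : 0 < p := by linarith
  obtain ⟨e, he0, hdense⟩ : ∃ e : ℕ → Euc d, e 0 = 0 ∧ ∀ x, x ∈ closure (Set.range e) := by
    let e : ℕ → Euc d := fun k => Nat.casesOn k 0 (TopologicalSpace.denseSeq (Euc d))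
    refine ⟨e, rfl, fun x => ?_⟩
    have h1 : Set.range (TopologicalSpace.denseSeq (Euc d)) ⊆ Set.range e := by
      rintro _ ⟨k, rfl⟩; exact ⟨k + 1, rfl⟩
    exact closure_mono h1 (TopologicalSpace.denseRange_denseSeq (Euc d) x)
  have hlim : Tendsto (fun N => ∫⁻ x, edist x (SimpleFunc.nearestPt e N x) ^ p ∂Q) atTop
      (𝓝 (∫⁻ x, 0 ∂Q)) := by
    refine tendsto_lintegral_of_dominated_convergence (fun x => edist x 0 ^ p) ?_ ?_ ?_ ?_
    · intro N
      have := (SimpleFunc.nearestPt e N).measurable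
      fun_prop
    · intro N
      refine ae_of_all _ fun x => ?_
      refine ENNReal.rpow_le_rpow ?_ hp0.le
      rw [edist_comm, edist_comm x 0, ← he0]
      exact SimpleFunc.edist_nearestPt_le e x (Nat.zero_le N)
    · unfold HasFinMom at hQ
      convert hQ using 3 with x
      rw [← aux_cost hp, sub_zero]
    · refine ae_of_all _ fun x => ?_
      have h := SimpleFunc.tendsto_nearestPt (hdense x)
      have h2 : Tendsto (fun N => edist x (SimpleFunc.nearestPt e N x)) atTop (𝓝 (edist x x)) :=
        tendsto_const_nhds.edist h
      have h3 := (ENNReal.continuous_rpow_const (y := p)).continuousAt.tendsto.comp h2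
      simpa [ENNReal.zero_rpow_of_pos hp0, Function.comp_def] using h3
  rw [lintegral_zero] at hlim
  obtain ⟨N, hN⟩ := (hlim.eventually (gt_mem_nhds (pos_iff_ne_zero.2 hη))).exists
  refine ⟨e, N, SimpleFunc.nearestPtInd e N, (SimpleFunc.nearestPtInd e N).measurable, ?_, ?_, hN⟩
  · intro x
    exact Finset.mem_range.2 (Nat.lt_succ_of_le (SimpleFunc.nearestPtInd_le e N x))
  · intro x y
    refine le_trans ?_ (edist_triangle _ _ _)
    rw [edist_comm, edist_comm x (e _)]
    exact SimpleFunc.edist_nearestPt_le e x (SimpleFunc.nearestPtInd_le e N y)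

lemma aux_sep {d : ℕ} (P Q : Measure (Euc d)) [IsProbabilityMeasure P] [IsProbabilityMeasure Q]
    (h : P ≠ Q) : ∃ (f : Euc d → ℝ) (L : NNReal), LipschitzWith L f ∧ (∀ x, |f x| ≤ 1) ∧
      ∫ y, f y ∂P ≠ ∫ y, f y ∂Q := by
  by_contra hcon
  push Not at hcon
  apply h
  apply Measure.ext_of_charFun
  funext t
  have hl : LipschitzWith ‖t‖₊ (fun x : Euc d => (inner ℝ x t : ℝ)) := by
    refine LipschitzWith.of_dist_le_mul fun x y => ?_
    rw [dist_eq_norm, dist_eq_norm, ← inner_sub_left, mul_comm]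
    exact norm_inner_le_norm _ _
  have hcos : LipschitzWith 1 Real.cos := by
    refine lipschitzWith_of_nnnorm_deriv_le Real.differentiable_cos fun x => ?_
    rw [← NNReal.coe_le_coe]
    simpa using Real.abs_sin_le_one x
  have hsin : LipschitzWith 1 Real.sin := by
    refine lipschitzWith_of_nnnorm_deriv_le Real.differentiable_sin fun x => ?_
    rw [← NNReal.coe_le_coe]
    simpa using Real.abs_cos_le_one x
  have h1 := hcon _ _ (hcos.comp hl) (fun x => Real.abs_cos_le_one _)
  have h2 := hcon _ _ (hsin.comp hl) (fun x => Real.abs_sin_le_one _)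
  have key : ∀ ν : Measure (Euc d), IsProbabilityMeasure ν → charFun ν t =
      ((∫ y, (Real.cos ∘ fun x : Euc d => (inner ℝ x t : ℝ)) y ∂ν : ℝ) : ℂ) +
      ((∫ y, (Real.sin ∘ fun x : Euc d => (inner ℝ x t : ℝ)) y ∂ν : ℝ) : ℂ) * Complex.I := by
    intro ν hν
    have hi : Integrable (fun x : Euc d => Complex.exp ((inner ℝ x t : ℝ) * Complex.I)) ν := by
      refine Integrable.of_bound ?_ 1 (ae_of_all _ fun x => ?_)
      · exact (by fun_prop : Continuous fun x : Euc d =>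
          Complex.exp ((inner ℝ x t : ℝ) * Complex.I)).aestronglyMeasurable
      · rw [Complex.norm_exp_ofReal_mul_I]
    rw [charFun_apply]
    apply Complex.ext
    · have := integral_re (𝕜 := ℂ) hi
      simp only [RCLike.re_eq_complex_re] at this
      rw [← this]
      simp [Complex.exp_ofReal_mul_I_re]
    · have := integral_im (𝕜 := ℂ) hi
      simp only [RCLike.im_eq_complex_im] at this
      rw [← this]
      simp [Complex.exp_ofReal_mul_I_im]
  rw [key P inferInstance, key Q inferInstance, h1, h2]

lemma aux_A {d : ℕ} {p : ℝ} (hp : 1 ≤ p) (Q : Measure (Euc d)) (hQ : HasFinMom p Q)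
    (s β : ℝ≥0∞) (hs : s ≠ 0) (hst : s ≠ ∞) (hβ : β ≠ 0) :
    ∃ τ : ℝ≥0∞, τ ≠ 0 ∧ ∃ n₀ : ℕ, ∀ n ≥ n₀, ∀ μ : Measure (Euc d), IsProbabilityMeasure μ →
      WpPow p μ Q < τ →
      prodn μ n {x | 2 ^ (p - 1) * (s + 2 ^ (p - 1) * (s + s)) < WpPow p (empDist x) μ} ≤ β := by
  have hp0 : 0 < p := by linarith
  set c : ℝ≥0∞ := 2 ^ (p - 1) with hc
  have hct : c ≠ ∞ := by simp [hc]
  have hm0 : min s (s * (β / 2)) ≠ 0 := by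
    have : 0 < min s (s * (β / 2)) := by
      refine lt_min (pos_iff_ne_zero.2 hs) ?_
      exact ENNReal.mul_pos hs (by simp [hβ])
    exact this.ne'
  obtain ⟨η, hη, -, hηle⟩ := aux_small (c * 2) (min s (s * (β / 2)))
    (ENNReal.mul_ne_top hct (by simp)) hm0
  obtain ⟨e, N, ind, hind, hmem, htri, hint⟩ := aux_quant hp Q hQ η hη
  have he : Measurable e := measurable_from_top
  have hT : Measurable fun x => e (ind x) := he.comp hind
  set D : ℝ≥0∞ := ∑ i ∈ Finset.range (N + 1), ∑ j ∈ Finset.range (N + 1), edist (e i) (e j) ^ p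
    with hD
  have hDt : D ≠ ∞ := by
    simp only [hD, ne_eq, ENNReal.sum_eq_top, not_exists, not_and]
    intro i _ j _
    exact ENNReal.rpow_ne_top_of_nonneg hp0.le (edist_ne_top _ _)
  have hDle : ∀ i ∈ Finset.range (N + 1), ∀ j ∈ Finset.range (N + 1),
      edist (e i) (e j) ^ p ≤ D := by
    intro i hi j hj
    refine le_trans ?_ (Finset.single_le_sum (f := fun i =>
      ∑ j ∈ Finset.range (N + 1), edist (e i) (e j) ^ p) (fun _ _ => zero_le) hi)
    exact Finset.single_le_sum (f := fun j => edist (e i) (e j) ^ p) (fun _ _ => zero_le) hj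
  obtain ⟨t', ht0, htt, htle⟩ := aux_small (D * (N + 1 : ℕ)) s
    (ENNReal.mul_ne_top hDt (by simp)) hs
  obtain ⟨t, ht, rfl⟩ : ∃ t : ℝ, 0 < t ∧ ENNReal.ofReal t = t' :=
    ⟨t'.toReal, ENNReal.toReal_pos ht0 htt, ENNReal.ofReal_toReal htt⟩
  -- sample size
  have hlim : Tendsto (fun n : ℕ => ((N + 1 : ℕ) : ℝ≥0∞) * ENNReal.ofReal (1 / (n * t ^ 2))) atTop
      (𝓝 0) := by
    have h1 : Tendsto (fun n : ℕ => 1 / ((n : ℝ) * t ^ 2)) atTop (𝓝 0) := by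
      have := (tendsto_natCast_atTop_atTop (R := ℝ)).atTop_mul_const (by positivity : 0 < t ^ 2)
      exact this.const_div_atTop 1
    have h2 := ENNReal.tendsto_ofReal h1
    have h3 := ENNReal.Tendsto.const_mul (a := ((N + 1 : ℕ) : ℝ≥0∞)) h2 (Or.inr (by simp))
    simpa using h3
  have hev := hlim.eventually (gt_mem_nhds (pos_iff_ne_zero.2
    (by simp [hβ] : β / 2 ≠ 0)))
  obtain ⟨n₀, hn₀⟩ := eventually_atTop.1 (hev.and (eventually_ge_atTop 1))
  refine ⟨η, hη, n₀, fun n hn μ hμ hW => ?_⟩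
  obtain ⟨hn1, hn2⟩ := hn₀ n hn
  have hn0 : n ≠ 0 := by omega
  -- quantization error for `μ`
  have hg : Measurable fun x => edist x (e (ind x)) ^ p := by fun_prop
  have hqμ : ∫⁻ x, edist x (e (ind x)) ^ p ∂μ ≤ min s (s * (β / 2)) := by
    refine le_trans ?_ hηle
    obtain ⟨γ, ⟨g1, g2, g3⟩, hγ⟩ := aux_WpPow_lt hp hW
    calc ∫⁻ x, edist x (e (ind x)) ^ p ∂μ = ∫⁻ z, edist z.1 (e (ind z.1)) ^ p ∂γ := by
          rw [← g2, lintegral_map hg measurable_fst]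
      _ ≤ ∫⁻ z, c * (edist z.1 z.2 ^ p + edist z.2 (e (ind z.2)) ^ p) ∂γ := by
          refine lintegral_mono fun z => ?_
          refine (ENNReal.rpow_le_rpow (htri z.1 z.2) hp0.le).trans ?_
          exact ENNReal.rpow_add_le_mul_rpow_add_rpow _ _ hp
      _ = c * (∫⁻ z, edist z.1 z.2 ^ p ∂γ + ∫⁻ x, edist x (e (ind x)) ^ p ∂Q) := by
          rw [lintegral_const_mul' _ _ hct, lintegral_add_left (by fun_prop), ← g3,
            lintegral_map hg measurable_snd]
      _ ≤ c * (η + η) := by gcongr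
      _ = η * (c * 2) := by ring
  have hsub : {x : Fin n → Euc d | c * (s + c * (s + s)) < WpPow p (empDist x) μ} ⊆
      {x | s ≤ ∫⁻ y, edist y (e (ind y)) ^ p ∂(empDist x)} ∪
      ⋃ j ∈ Finset.range (N + 1), {x | t ≤ |∫ y, (ind ⁻¹' {j}).indicator 1 y ∂(empDist x) -
        ∫ y, (ind ⁻¹' {j}).indicator (1 : Euc d → ℝ) y ∂μ|} := by
    intro x hx
    by_contra hcon
    simp only [Set.mem_union, Set.mem_iUnion, Set.mem_ofPred_eq, not_or, not_le, not_exists]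
      at hcon hx
    obtain ⟨hc1, hc2⟩ := hcon
    refine absurd hx (not_lt.2 ?_)
    have hpe : IsProbabilityMeasure (empDist x) := aux_emp_prob hn0 x
    refine (aux_tri hp _ ((empDist x).map fun x => e (ind x)) _).trans ?_
    refine mul_le_mul_right (add_le_add ((aux_map hp _ _ hT).trans hc1.le) ?_) _
    refine (aux_tri hp _ (μ.map fun x => e (ind x)) _).trans ?_
    refine mul_le_mul_right (add_le_add ?_ ?_) _
    · rw [aux_mapT _ (N + 1) e ind hind hmem, aux_mapT _ (N + 1) e ind hind hmem]
      have hone : ∀ ν : Measure (Euc d), IsProbabilityMeasure ν →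
          ∑ j ∈ Finset.range (N + 1), ν (ind ⁻¹' {j}) = 1 := by
        intro ν hν
        have : ν.map (fun x => e (ind x)) Set.univ = 1 := by
          rw [Measure.map_apply hT MeasurableSet.univ]; simp
        rw [aux_mapT _ (N + 1) e ind hind hmem] at this
        simpa [Measure.finsetSum_apply] using this
      refine (aux_disc hp (N + 1) e _ _ (hone _ hpe) (hone _ hμ) D hDle).trans ?_
      refine le_trans ?_ htle
      have : ∑ j ∈ Finset.range (N + 1), ((empDist x) (ind ⁻¹' {j}) - μ (ind ⁻¹' {j})) ≤
          ∑ j ∈ Finset.range (N + 1), ENNReal.ofReal t := by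
        refine Finset.sum_le_sum fun j hj => ?_
        have h := hc2 j hj
        have hms : MeasurableSet (ind ⁻¹' {j}) := hind (measurableSet_singleton j)
        rw [integral_indicator_one hms, integral_indicator_one hms] at h
        have h' := (abs_lt.1 h).2
        rw [tsub_le_iff_right, ← ofReal_measureReal (μ := empDist x),
          ← ofReal_measureReal (μ := μ), ← ENNReal.ofReal_add ht.le measureReal_nonneg]
        exact ENNReal.ofReal_le_ofReal (by linarith)
      calc _ ≤ D * ∑ j ∈ Finset.range (N + 1), ENNReal.ofReal t := by gcongr
        _ = _ := by simp; ring
    · rw [aux_WpPow_comm hp]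
      exact (aux_map hp _ _ hT).trans (hqμ.trans (min_le_left _ _))
  refine (measure_mono hsub).trans ((measure_union_le _ _).trans ?_)
  rw [← ENNReal.add_halves β]
  refine add_le_add ?_ ?_
  · refine (aux_markov hn0 μ _ hg s hs hst).trans ?_
    refine ENNReal.div_le_of_le_mul ?_
    rw [mul_comm]
    exact hqμ.trans (min_le_right _ _)
  · refine (measure_biUnion_finset_le _ _).trans ?_
    refine le_trans ?_ hn1.le
    calc _ ≤ ∑ j ∈ Finset.range (N + 1), ENNReal.ofReal (1 / (n * t ^ 2)) := by
          refine Finset.sum_le_sum fun j _ => ?_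
          have hms : MeasurableSet (ind ⁻¹' {j}) := hind (measurableSet_singleton j)
          refine aux_cheb hn0 μ _ (measurable_one.indicator hms) (fun x => ?_) t ht
          by_cases h : x ∈ ind ⁻¹' {j} <;> simp [Set.indicator, h]
      _ = _ := by simp

lemma aux_cont {d : ℕ} {p : ℝ} (hp : 1 ≤ p) {Θ : Type*} [MetricSpace Θ]
    (Pfam : Θ → Measure (Euc d))
    (hcont : ∀ θ₀ : Θ, ∀ ε > (0 : ℝ), ∃ δ > (0 : ℝ), ∀ θ : Θ,
      dist θ θ₀ < δ → Wp p (Pfam θ) (Pfam θ₀) < ENNReal.ofReal ε)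
    (θ₀ : Θ) (τ : ℝ≥0∞) (hτ : τ ≠ 0) :
    ∃ δ > (0 : ℝ), ∀ θ : Θ, dist θ θ₀ < δ → WpPow p (Pfam θ) (Pfam θ₀) < τ := by
  have hp0 : 0 < p := by linarith
  have h0 : 0 < min τ 1 := lt_min (pos_iff_ne_zero.2 hτ) one_pos
  have ht : min τ 1 ≠ ∞ := ((min_le_right _ _).trans_lt ENNReal.one_lt_top).ne
  have hpos : 0 < (min τ 1).toReal := ENNReal.toReal_pos h0.ne' ht
  obtain ⟨δ, hδ, h⟩ := hcont θ₀ ((min τ 1).toReal ^ (1 / p)) (by positivity)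
  refine ⟨δ, hδ, fun θ hθ => ?_⟩
  have := h θ hθ
  rw [Wp, ← ENNReal.ofReal_rpow_of_pos hpos, ENNReal.ofReal_toReal ht,
    ENNReal.rpow_lt_rpow_iff (by positivity)] at this
  exact this.trans_le (min_le_left _ _)

lemma aux_critical {d : ℕ} {p : ℝ} (hp : 1 ≤ p) {Θ : Type*} [MetricSpace Θ]
    (Pfam : Θ → Measure (Euc d))
    (hprob : ∀ θ, IsProbabilityMeasure (Pfam θ))
    (hmom : ∀ θ, HasFinMom p (Pfam θ))
    (hcW : ∀ θ₀ : Θ, ∀ τ : ℝ≥0∞, τ ≠ 0 →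
      ∃ δ > (0 : ℝ), ∀ θ : Θ, dist θ θ₀ < δ → WpPow p (Pfam θ) (Pfam θ₀) < τ)
    (est : (n : ℕ) → (Fin n → Euc d) → Θ)
    (hcons : ∀ ε > (0 : ℝ), ∀ K : Set Θ, IsCompact K →
      Tendsto (fun n : ℕ => ⨆ θ ∈ K, prodn (Pfam θ) n {x | ε < dist (est n x) θ})
        atTop (𝓝 0))
    (K : Set Θ) (hK : IsCompact K) (ε β : ℝ≥0∞) (hε : ε ≠ 0) (hβ : β ≠ 0) :
    ∃ n₀ : ℕ, ∀ n ≥ n₀, ∀ θ ∈ K,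
      prodn (Pfam θ) n {y | ε < WpPow p (empDist y) (Pfam (est n y))} ≤ β := by
  set c : ℝ≥0∞ := 2 ^ (p - 1) with hc
  have hct : c ≠ ∞ := by simp [hc]
  have hβ2 : β / 2 ≠ 0 := by simp [hβ]
  obtain ⟨s, hs, hst, hsle⟩ := aux_small (c * (c * (1 + c * 2) + c * 2)) ε (by finiteness) hε
  -- uniform law of large numbers over `K`
  have hA : ∃ n₀ : ℕ, ∀ n ≥ n₀, ∀ θ ∈ K,
      prodn (Pfam θ) n {x | c * (s + c * (s + s)) < WpPow p (empDist x) (Pfam θ)} ≤ β / 2 := by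
    refine hK.induction_on (p := fun S => ∃ n₀ : ℕ, ∀ n ≥ n₀, ∀ θ ∈ S,
      prodn (Pfam θ) n {x | c * (s + c * (s + s)) < WpPow p (empDist x) (Pfam θ)} ≤ β / 2)
      ⟨0, by simp⟩ ?_ ?_ ?_
    · rintro S T hST ⟨n₀, h⟩
      exact ⟨n₀, fun n hn θ hθ => h n hn θ (hST hθ)⟩
    · rintro S T ⟨n₀, h⟩ ⟨n₁, h'⟩
      refine ⟨max n₀ n₁, fun n hn θ hθ => ?_⟩
      rcases hθ with hθ | hθ
      · exact h n (le_trans (le_max_left _ _) hn) θ hθ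
      · exact h' n (le_trans (le_max_right _ _) hn) θ hθ
    · intro θ₀ _
      obtain ⟨τ, hτ, n₀, h⟩ := aux_A hp (Pfam θ₀) (hmom θ₀) s (β / 2) hs hst hβ2
      obtain ⟨δ, hδ, h'⟩ := hcW θ₀ τ hτ
      refine ⟨Metric.ball θ₀ δ, mem_nhdsWithin_of_mem_nhds (Metric.ball_mem_nhds _ hδ), n₀, ?_⟩
      intro n hn θ hθ
      have hclose := h' θ hθ
      exact h n hn _ (hprob θ) hclose
  -- uniform continuity near `K`
  have hU : ∃ δ > (0 : ℝ), ∀ θ ∈ K, ∀ θ', dist θ' θ ≤ δ →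
      WpPow p (Pfam θ) (Pfam θ') ≤ c * (s + s) := by
    refine hK.induction_on (p := fun S => ∃ δ > (0 : ℝ), ∀ θ ∈ S, ∀ θ', dist θ' θ ≤ δ →
      WpPow p (Pfam θ) (Pfam θ') ≤ c * (s + s)) ⟨1, one_pos, by simp⟩ ?_ ?_ ?_
    · rintro S T hST ⟨δ, hδ, h⟩
      exact ⟨δ, hδ, fun θ hθ => h θ (hST hθ)⟩
    · rintro S T ⟨δ, hδ, h⟩ ⟨δ', hδ', h'⟩
      refine ⟨min δ δ', lt_min hδ hδ', fun θ hθ θ' hd => ?_⟩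
      rcases hθ with hθ | hθ
      · exact h θ hθ θ' (hd.trans (min_le_left _ _))
      · exact h' θ hθ θ' (hd.trans (min_le_right _ _))
    · intro θ₀ _
      obtain ⟨δ, hδ, h'⟩ := hcW θ₀ s hs
      refine ⟨Metric.ball θ₀ (δ / 2), mem_nhdsWithin_of_mem_nhds
        (Metric.ball_mem_nhds _ (by positivity)), δ / 2, by positivity, ?_⟩
      intro θ hθ θ' hd
      have hθ' : dist θ θ₀ < δ / 2 := hθ
      refine (aux_tri hp _ (Pfam θ₀) _).trans ?_
      refine mul_le_mul_right (add_le_add (h' θ (by linarith)).le ?_) _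
      rw [aux_WpPow_comm hp]
      refine (h' θ' ?_).le
      have := dist_triangle θ' θ θ₀
      linarith
  obtain ⟨n₀, hn₀⟩ := hA
  obtain ⟨δ, hδ, hU⟩ := hU
  have hev := (hcons δ hδ K hK).eventually (gt_mem_nhds (pos_iff_ne_zero.2 hβ2))
  obtain ⟨n₁, hn₁⟩ := eventually_atTop.1 hev
  refine ⟨max n₀ n₁, fun n hn θ hθ => ?_⟩
  have h1 := hn₀ n (le_trans (le_max_left _ _) hn) θ hθ
  have h2 : prodn (Pfam θ) n {x | δ < dist (est n x) θ} ≤ β / 2 :=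
    (le_iSup₂ (f := fun θ (_ : θ ∈ K) => prodn (Pfam θ) n {x | δ < dist (est n x) θ}) θ hθ).trans
      (hn₁ n (le_trans (le_max_right _ _) hn)).le
  have hsub : {y : Fin n → Euc d | ε < WpPow p (empDist y) (Pfam (est n y))} ⊆
      {x | c * (s + c * (s + s)) < WpPow p (empDist x) (Pfam θ)} ∪
      {x | δ < dist (est n x) θ} := by
    intro x hx
    by_contra hcon
    simp only [Set.mem_union, Set.mem_ofPred_eq, not_or, not_lt] at hcon hx
    refine absurd hx (not_lt.2 ?_)
    refine (aux_tri hp _ (Pfam θ) _).trans (le_trans ?_ hsle)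
    refine (mul_le_mul_right (add_le_add hcon.1 (hU θ hθ _ hcon.2)) _).trans (le_of_eq ?_)
    rw [← hc]; ring
  refine (measure_mono hsub).trans ((measure_union_le _ _).trans ?_)
  rw [← ENNReal.add_halves β]
  exact add_le_add h1 h2

lemma aux_alternative {d : ℕ} {p : ℝ} (hp : 1 ≤ p) {Θ : Type*} [MetricSpace Θ]
    (Pfam : Θ → Measure (Euc d))
    (hprob : ∀ θ, IsProbabilityMeasure (Pfam θ))
    (hcW : ∀ θ₀ : Θ, ∀ τ : ℝ≥0∞, τ ≠ 0 →
      ∃ δ > (0 : ℝ), ∀ θ : Θ, dist θ θ₀ < δ → WpPow p (Pfam θ) (Pfam θ₀) < τ)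
    (P : Measure (Euc d)) [IsProbabilityMeasure P] (hPnotM : ∀ θ : Θ, P ≠ Pfam θ)
    (K : Set Θ) (hK : IsCompact K) :
    ∃ ε > (0 : ℝ), Tendsto (fun n : ℕ =>
      prodn P n {x | ∃ θ ∈ K, WpPow p (empDist x) (Pfam θ) < ENNReal.ofReal ε}) atTop (𝓝 0) := by
  refine hK.induction_on (p := fun S => ∃ ε > (0 : ℝ), Tendsto (fun n : ℕ =>
      prodn P n {x | ∃ θ ∈ S, WpPow p (empDist x) (Pfam θ) < ENNReal.ofReal ε}) atTop (𝓝 0))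
      ⟨1, one_pos, by simp⟩ ?_ ?_ ?_
  · rintro S T hST ⟨ε, hε, h⟩
    refine ⟨ε, hε, tendsto_of_tendsto_of_tendsto_of_le_of_le tendsto_const_nhds h
      (fun _ => zero_le) fun n => measure_mono ?_⟩
    rintro x ⟨θ, hθ, hx⟩
    exact ⟨θ, hST hθ, hx⟩
  · rintro S T ⟨ε, hε, h⟩ ⟨ε', hε', h'⟩
    have hadd := h.add h'
    rw [add_zero] at hadd
    refine ⟨min ε ε', lt_min hε hε', tendsto_of_tendsto_of_tendsto_of_le_of_le
      tendsto_const_nhds hadd (fun _ => zero_le) fun n => ?_⟩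
    refine le_trans (measure_mono ?_) (measure_union_le _ _)
    rintro x ⟨θ, hθ | hθ, hx⟩
    · exact Or.inl ⟨θ, hθ, hx.trans_le (ENNReal.ofReal_le_ofReal (min_le_left _ _))⟩
    · exact Or.inr ⟨θ, hθ, hx.trans_le (ENNReal.ofReal_le_ofReal (min_le_right _ _))⟩
  · intro θ₀ _
    have := hprob θ₀
    obtain ⟨f, L, hf, hb, hne⟩ := aux_sep P (Pfam θ₀) (hPnotM θ₀)
    set Δ := |∫ y, f y ∂P - ∫ y, f y ∂(Pfam θ₀)| with hΔ
    have hΔ0 : 0 < Δ := abs_pos.2 (sub_ne_zero.2 hne)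
    set η : ℝ := Δ / (6 * (L + 1)) with hη
    have hL : (0 : ℝ) ≤ L := L.2
    have hη0 : 0 < η := by positivity
    have hηL : 2 * L * η < Δ / 3 := by
      have : Δ = η * (6 * (L + 1)) := by rw [hη]; field_simp
      nlinarith
    have hηp : 0 < η ^ p := by positivity
    obtain ⟨δ, hδ, h'⟩ := hcW θ₀ (ENNReal.ofReal (η ^ p)) (by simpa using hηp)
    refine ⟨Metric.ball θ₀ δ, mem_nhdsWithin_of_mem_nhds (Metric.ball_mem_nhds _ hδ),
      η ^ p, hηp, ?_⟩
    have hlim : Tendsto (fun n : ℕ => ENNReal.ofReal (1 / (n * (Δ / 3) ^ 2))) atTop (𝓝 0) := by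
      have h1 : Tendsto (fun n : ℕ => 1 / ((n : ℝ) * (Δ / 3) ^ 2)) atTop (𝓝 0) := by
        have := (tendsto_natCast_atTop_atTop (R := ℝ)).atTop_mul_const
          (by positivity : 0 < (Δ / 3) ^ 2)
        exact this.const_div_atTop 1
      simpa using ENNReal.tendsto_ofReal h1
    refine tendsto_of_tendsto_of_tendsto_of_le_of_le' tendsto_const_nhds hlim
      (Eventually.of_forall fun _ => zero_le) ?_
    filter_upwards [eventually_ge_atTop 1] with n hn
    have hn0 : n ≠ 0 := by omega
    refine le_trans (measure_mono ?_)
      (aux_cheb hn0 P f hf.continuous.measurable hb (Δ / 3) (by positivity))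
    rintro x ⟨θ, hθ, hx⟩
    have := hprob θ
    have hpe : IsProbabilityMeasure (empDist x) := aux_emp_prob hn0 x
    have k1 := aux_kant hp _ _ f L hf hb η hη0 hx
    have k2 := aux_kant hp _ _ f L hf hb η hη0 (h' θ hθ)
    change Δ / 3 ≤ |∫ y, f y ∂(empDist x) - ∫ y, f y ∂P|
    have t1 := abs_sub_le (∫ y, f y ∂P) (∫ y, f y ∂(empDist x)) (∫ y, f y ∂(Pfam θ₀))
    have t2 := abs_sub_le (∫ y, f y ∂(empDist x)) (∫ y, f y ∂(Pfam θ)) (∫ y, f y ∂(Pfam θ₀))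
    rw [abs_sub_comm (∫ y, f y ∂P) (∫ y, f y ∂(empDist x))] at t1
    linarith

/-- Proposition on general parametric families, part (iii): consistency of the
parametric-bootstrap test against fixed alternatives.  Under the same assumptions (a) and (b)
as part (i), if `P ∉ M` (not necessarily with finite `p`-th moment) and there is a compact
`K ⊆ Θ` with `Pⁿ[θ̂_n ∈ K] → 1`, then `Pⁿ[T_{M,n} ≥ c_M(α, n, θ̂_n)] → 1` for every
`α ∈ (0,1)`. -/
theorem parametric_bootstrap_test_consistent {d : ℕ} (p : ℝ) (hp : 1 ≤ p)
    {Θ : Type*} [MetricSpace Θ] [MeasurableSpace Θ] [BorelSpace Θ]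
    (Pfam : Θ → Measure (Euc d))
    (hprob : ∀ θ, IsProbabilityMeasure (Pfam θ))
    (hmom : ∀ θ, HasFinMom p (Pfam θ))
    -- (a) one-to-one and `W_p`-continuous
    (hinj : Function.Injective Pfam)
    (hcont : ∀ θ₀ : Θ, ∀ ε > (0 : ℝ), ∃ δ > (0 : ℝ), ∀ θ : Θ,
      dist θ θ₀ < δ → Wp p (Pfam θ) (Pfam θ₀) < ENNReal.ofReal ε)
    -- measurable estimator
    (est : (n : ℕ) → (Fin n → Euc d) → Θ)
    (hmeas : ∀ n, Measurable (est n))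
    -- (b) weak consistency locally uniformly in `θ`
    (hcons : ∀ ε > (0 : ℝ), ∀ K : Set Θ, IsCompact K →
      Tendsto (fun n : ℕ => ⨆ θ ∈ K, prodn (Pfam θ) n {x | ε < dist (est n x) θ})
        atTop (𝓝 0))
    -- the fixed alternative
    (P : Measure (Euc d)) [IsProbabilityMeasure P]
    (hPnotM : ∀ θ : Θ, P ≠ Pfam θ)
    (K : Set Θ) (hK : IsCompact K)
    (hestK : Tendsto (fun n : ℕ => prodn P n {x | est n x ∈ K}) atTop (𝓝 1))
    (α : ℝ) (hα : α ∈ Set.Ioo (0 : ℝ) 1) :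
    Tendsto (fun n : ℕ =>
        prodn P n {x |
          ENNReal.ofReal
              (sInf {t : ℝ | 0 ≤ t ∧
                ENNReal.ofReal (1 - α) ≤
                  prodn (Pfam (est n x)) n
                    {y | WpPow p (empDist y) (Pfam (est n y)) ≤ ENNReal.ofReal t}})
            ≤ WpPow p (empDist x) (Pfam (est n x))})
      atTop (𝓝 1) := by
  have hcW := aux_cont hp Pfam hcont
  obtain ⟨ε, hε, hB⟩ := aux_alternative hp Pfam hprob hcW P hPnotM K hK
  obtain ⟨n₀, hn₀⟩ := aux_critical hp Pfam hprob hmom hcW est hcons K hK (ENNReal.ofReal ε)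
    (ENNReal.ofReal α) (by simpa using hε) (by simpa using hα.1)
  have hprobn : ∀ μ : Measure (Euc d), IsProbabilityMeasure μ → ∀ n,
      IsProbabilityMeasure (prodn μ n) := by
    intro μ hμ n; unfold prodn; infer_instance
  have hlow := ENNReal.Tendsto.sub hestK hB (Or.inl ENNReal.one_ne_top)
  rw [tsub_zero] at hlow
  refine tendsto_of_tendsto_of_tendsto_of_le_of_le' hlow tendsto_const_nhds ?_ ?_
  · filter_upwards [eventually_ge_atTop n₀] with n hn
    rw [tsub_le_iff_right]
    refine le_trans (measure_mono ?_) (measure_union_le _ _)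
    intro x hx
    have hx : est n x ∈ K := hx
    by_cases hbad : ∃ θ ∈ K, WpPow p (empDist x) (Pfam θ) < ENNReal.ofReal ε
    · exact Or.inr hbad
    · left
      push Not at hbad
      refine le_trans (ENNReal.ofReal_le_ofReal (csInf_le (a := ε) ?_ ?_)) (hbad _ hx)
      · exact ⟨0, fun t ht => ht.1⟩
      refine ⟨hε.le, ?_⟩
      have := hprobn _ (hprob (est n x)) n
      have h1 := hn₀ n hn _ hx
      rw [ENNReal.ofReal_sub _ hα.1.le, ENNReal.ofReal_one, tsub_le_iff_right,
        ← measure_univ (μ := prodn (Pfam (est n x)) n)]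
      refine le_trans ?_ (add_le_add le_rfl h1)
      refine le_trans (measure_mono ?_) (measure_union_le _ _)
      intro y _
      exact le_or_gt (WpPow p (empDist y) (Pfam (est n y))) (ENNReal.ofReal ε)
  · refine Eventually.of_forall fun n => ?_
    have := hprobn P inferInstance n
    exact prob_le_one
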